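/- Let * be a truncation on a vector lattice L, let P be a proper prime ideal of L, and let u ∈ π*(P). Then {α ∈ ℝ : (u* − α u*)⁺ ∈ P} = [1, ∞); in particular, the infimum of this set is 1 (i.e., the representing function of u* takes the value 1 at P). -/

import Mathlib

/-- A truncation on a vector lattice `L`: a map sending each positive element to a
positive element, not identically zero on the positive cone, satisfying
(a) `f ⊓ g* ≤ f* ≤ f` for all `f, g ∈ L⁺`, and
(b) if `f ∈ L⁺` and `(n • f)* = n • f` for all `n ≥ 1`, then `f = 0`. -/
structure Truncation (L : Type*) [Lattice L] [AddCommGroup L] where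
  toFun : L → L
  map_nonneg' : ∀ f : L, 0 ≤ f → 0 ≤ toFun f
  nonzero' : ∃ f : L, 0 ≤ f ∧ toFun f ≠ 0
  inf_le' : ∀ f g : L, 0 ≤ f → 0 ≤ g → f ⊓ toFun g ≤ toFun f
  le_self' : ∀ f : L, 0 ≤ f → toFun f ≤ f
  arch' : ∀ f : L, 0 ≤ f → (∀ n : ℕ, 1 ≤ n → toFun (n • f) = n • f) → f = 0

/-- An (order) ideal of a vector lattice: a vector subspace which is solid. -/
def IsLatticeIdeal {L : Type*} [Lattice L] [AddCommGroup L] [Module ℝ L]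
    (P : Submodule ℝ L) : Prop :=
  ∀ f ∈ P, ∀ g : L, |g| ≤ |f| → g ∈ P

/-- A proper prime ideal of a vector lattice: a solid vector subspace `P ≠ L`
such that `f ⊓ g ∈ P` implies `f ∈ P` or `g ∈ P`. -/
def IsProperPrimeIdeal {L : Type*} [Lattice L] [AddCommGroup L] [Module ℝ L]
    (P : Submodule ℝ L) : Prop :=
  IsLatticeIdeal P ∧ P ≠ ⊤ ∧ ∀ f g : L, f ⊓ g ∈ P → f ∈ P ∨ g ∈ P

namespace Truncation

variable {L : Type*} [Lattice L] [AddCommGroup L] [CovariantClass L L (· + ·) (· ≤ ·)]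

theorem toFun_sub_toFun_le (t : Truncation L) {u : L} (hu : 0 ≤ u) :
    t.toFun (u - t.toFun u) ≤ t.toFun u := by
  have hv : 0 ≤ u - t.toFun u := sub_nonneg.2 (t.le_self' u hu)
  have hle : t.toFun (u - t.toFun u) ≤ u :=
    (t.le_self' _ hv).trans (sub_le_self u (t.map_nonneg' u hu))
  simpa [inf_eq_right.2 hle] using t.inf_le' u _ hu hv

end Truncation

theorem IsLatticeIdeal.mem_of_nonneg_of_le {L : Type*} [Lattice L] [AddCommGroup L]
    [CovariantClass L L (· + ·) (· ≤ ·)] [Module ℝ L] {P : Submodule ℝ L}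
    (hP : IsLatticeIdeal P) {f g : L} (hf : f ∈ P) (hg : 0 ≤ g) (hgf : g ≤ f) : g ∈ P :=
  hP f hf g (by rwa [abs_of_nonneg hg, abs_of_nonneg (hg.trans hgf)])

theorem posPart_sub_smul_mem_iff {L : Type*} [Lattice L] [AddCommGroup L]
    [CovariantClass L L (· + ·) (· ≤ ·)] [Module ℝ L] [PosSMulMono ℝ L]
    {P : Submodule ℝ L} {f : L} (hf : 0 ≤ f) (hfP : f ∉ P) (α : ℝ) :
    (f - α • f) ⊔ 0 ∈ P ↔ 1 ≤ α := by
  have hsub : f - α • f = (1 - α) • f := by rw [sub_smul, one_smul]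
  rcases le_or_gt 1 α with h | h
  · have hle : f - α • f ≤ 0 := by
      have := smul_nonneg (sub_nonneg.2 h) hf
      rwa [← neg_sub 1 α, neg_smul, ← hsub, neg_nonneg] at this
    simp [sup_eq_right.2 hle, h]
  · have hpos : 0 < 1 - α := sub_pos.2 h
    rw [hsub, sup_eq_left.2 (smul_nonneg hpos.le hf), P.smul_mem_iff hpos.ne']
    simp [hfP, h]

/-- Let `*` be a truncation on a vector lattice `L`, `P` a proper prime ideal of `L`, and
`u ∈ π*(P)` (i.e. `0 ≤ u` and `(u - u*)* ∉ P`). Then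
`{α ∈ ℝ : (u* - α • u*)⁺ ∈ P} = [1, ∞)`, and in particular its infimum is `1`. -/
theorem stmt_17 {L : Type*} [Lattice L] [AddCommGroup L]
    [CovariantClass L L (· + ·) (· ≤ ·)] [Module ℝ L] [PosSMulMono ℝ L]
    (t : Truncation L) (P : Submodule ℝ L) (hP : IsProperPrimeIdeal P)
    (u : L) (hu : 0 ≤ u) (hu' : t.toFun (u - t.toFun u) ∉ P) :
    {α : ℝ | (t.toFun u - α • t.toFun u) ⊔ 0 ∈ P} = Set.Ici (1 : ℝ) ∧
      sInf {α : ℝ | (t.toFun u - α • t.toFun u) ⊔ 0 ∈ P} = 1 := by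
  have huP : t.toFun u ∉ P := fun h ↦ hu' <| hP.1.mem_of_nonneg_of_le h
    (t.map_nonneg' _ (sub_nonneg.2 (t.le_self' u hu))) (t.toFun_sub_toFun_le hu)
  have hset : {α : ℝ | (t.toFun u - α • t.toFun u) ⊔ 0 ∈ P} = Set.Ici (1 : ℝ) :=
    Set.ext fun α ↦ posPart_sub_smul_mem_iff (t.map_nonneg' u hu) huP α
  exact ⟨hset, by rw [hset, csInf_Ici]⟩
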